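/- Let f, g : ℍ → ℂ be non-constant j-maps, i.e., f(z) = j(γz), g(z) = j(δz) for γ, δ ∈ GL₂⁺(ℚ). If af + bg + c = 0 identically on ℍ for complex (a,b,c) ≠ (0,0,0), then f = g, a + b = 0, and c = 0. -/

import Mathlib

open scoped Real

/-- The modular `j`-function, defined via its `q`-expansion data: `j = E₄³ / Δ`, where
`E₄(τ) = 1 + 240 ∑ σ₃(n) qⁿ` and `Δ(τ) = q ∏ (1 - qⁿ)²⁴` with `q = e^{2πiτ}`. -/
noncomputable def jFun (z : ℂ) : ℂ :=
  (1 + 240 * ∑' n : ℕ, (∑ d ∈ (n + 1).divisors, (d : ℂ) ^ 3) *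
      Complex.exp (2 * (π : ℂ) * Complex.I * z) ^ (n + 1)) ^ 3 /
    (Complex.exp (2 * (π : ℂ) * Complex.I * z) *
      ∏' n : ℕ, (1 - Complex.exp (2 * (π : ℂ) * Complex.I * z) ^ (n + 1)) ^ 24)

/-- The action of a rational matrix on the upper half-plane by fractional linear
transformations. -/
noncomputable def moebius (γ : Matrix (Fin 2) (Fin 2) ℚ) (z : ℂ) : ℂ :=
  ((γ 0 0 : ℂ) * z + (γ 0 1 : ℂ)) / ((γ 1 0 : ℂ) * z + (γ 1 1 : ℂ))

open UpperHalfPlane ModularForm MatrixGroups Filter Topology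

lemma jFun_coe (z : ℍ) : jFun z = E₄ z ^ 3 / discriminant z := by
  have hE : E₄ z = 1 + 240 * ∑' n : ℕ, (∑ d ∈ (n + 1).divisors, (d : ℂ) ^ 3) *
      Complex.exp (2 * (π : ℂ) * Complex.I * z) ^ (n + 1) := by
    have h := EisensteinSeries.q_expansion_bernoulli (k := 4) (by norm_num) ⟨2, rfl⟩ z
    simp_rw [zpow_natCast] at h
    rw [h, tsum_pnat_eq_tsum_succ (f := fun n ↦ ((ArithmeticFunction.sigma (4 - 1) n : ℕ) : ℂ) *
      Complex.exp (2 * (π : ℂ) * Complex.I * z) ^ n),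
      show bernoulli 4 = -1 / 30 by norm_num [bernoulli]]
    norm_num [ArithmeticFunction.sigma_apply]
  rw [hE, discriminant_eq_q_prod, jFun]
  simp [Function.Periodic.qParam, eta_q_eq_pow]

lemma jFun_smul (γ : SL(2, ℤ)) (z : ℍ) : jFun ↑(γ • z) = jFun z := by
  have hγ : Matrix.SpecialLinearGroup.mapGL ℝ γ ∈ 𝒮ℒ := ⟨γ, rfl⟩
  have hE := SlashInvariantForm.slash_action_eqn'' E₄ hγ z
  have hD := SlashInvariantForm.slash_action_eqn'' CuspForm.discriminant hγ z
  rw [jFun_coe, jFun_coe]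
  have hd := denom_ne_zero (Matrix.SpecialLinearGroup.mapGL ℝ γ) z
  have hz := discriminant_ne_zero z
  change E₄ (γ • z) = _ at hE
  change discriminant (γ • z) = _ * discriminant z at hD
  rw [hE, hD]
  field_simp

lemma tendsto_jFun_mul_qParam :
    Tendsto (fun z : ℍ ↦ jFun z * Function.Periodic.qParam 1 z) atImInfty (𝓝 1) := by
  have hE : Tendsto E₄ atImInfty (𝓝 1) := by
    have hanal := ModularFormClass.analyticAt_cuspFunction_zero E₄ one_pos one_mem_strictPeriods_SL
    have hper := SlashInvariantFormClass.periodic_comp_ofComplex E₄ one_mem_strictPeriods_SL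
    have h0 := EisensteinSeries.E_qExpansion_coeff_zero (k := 4) (by norm_num) ⟨2, rfl⟩
    rw [qExpansion_coeff_zero one_pos hanal hper, ← cuspFunction_apply_zero one_pos hanal hper]
      at h0
    rw [← h0]
    exact (hanal.continuousAt.tendsto.comp (qParam_tendsto_atImInfty one_pos)).congr
      fun τ ↦ SlashInvariantFormClass.eq_cuspFunction E₄ τ one_mem_strictPeriods_SL one_ne_zero
  have := (hE.pow 3).div tendsto_atImInfty_tprod_one_sub_eta_q_pow one_ne_zero
  rw [one_pow, div_one] at this
  refine this.congr fun z ↦ ?_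
  rw [Pi.div_apply, jFun_coe, discriminant_eq_q_prod]
  have := Function.Periodic.qParam_ne_zero (h := 1) (z : ℂ)
  field_simp

lemma tendsto_norm_jFun_mul_exp {α : ℝ} (hα : 0 < α) (β : ℝ) :
    Tendsto (fun y : ℝ ↦ ‖jFun (α * (y * Complex.I) + β)‖ * Real.exp (-(2 * π * α) * y))
      atTop (𝓝 1) := by
  have him (y : ℝ) : (α * (y * Complex.I) + β).im = α * y := by simp
  have ht : Tendsto (fun y : ℝ ↦ ofComplex (α * (y * Complex.I) + β)) atTop atImInfty := by
    refine tendsto_comap_im_ofComplex.comp (tendsto_comap_iff.mpr ?_)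
    simpa [Function.comp_def] using tendsto_id.const_mul_atTop hα
  have := (tendsto_jFun_mul_qParam.comp ht).norm
  rw [norm_one] at this
  refine this.congr' ?_
  filter_upwards [eventually_gt_atTop 0] with y hy
  have hy' : 0 < (α * (y * Complex.I) + β).im := by rw [him]; positivity
  rw [Function.comp_apply, ofComplex_apply_of_im_pos hy', norm_mul]
  simp [Function.Periodic.norm_qParam]
  left
  ring

/-- Two `j`-functions rescaled by different factors have different growth rates. -/
lemma scale_le_one_of_linear_relation {α β : ℝ} (hα : 0 < α) {a b c : ℂ} (hb : b ≠ 0)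
    (h : ∀ z : ℂ, 0 < z.im → a * jFun z + b * jFun (α * z + β) + c = 0) : α ≤ 1 := by
  by_contra! hlt
  have h1 := tendsto_norm_jFun_mul_exp one_pos 0
  have hα' := tendsto_norm_jFun_mul_exp hα β
  have he {k : ℝ} (hk : k < 0) : Tendsto (fun y : ℝ ↦ Real.exp (k * y)) atTop (𝓝 0) :=
    Real.tendsto_exp_atBot.comp (tendsto_id.const_mul_atTop_of_neg hk)
  have hlim := ((h1.mul (he (k := -(2 * π * (α - 1))) (by nlinarith [Real.pi_pos]))).const_mul
    ‖a‖).add ((he (k := -(2 * π * α)) (by nlinarith [Real.pi_pos])).const_mul ‖c‖)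
  have hle := le_of_tendsto_of_tendsto (hα'.const_mul ‖b‖) hlim ?_
  · norm_num at hle
    exact hb hle
  · filter_upwards [eventually_gt_atTop 0] with y hy
    have hz := h (y * Complex.I) (by simpa)
    have hn : ‖b * jFun (α * (y * Complex.I) + β)‖ ≤ ‖a‖ * ‖jFun (y * Complex.I)‖ + ‖c‖ := by
      rw [show b * jFun (α * (y * Complex.I) + β) = -(a * jFun (y * Complex.I) + c) by
        linear_combination hz, norm_neg, ← norm_mul]
      exact norm_add_le _ _
    rw [norm_mul] at hn
    have hexp : Real.exp (-(2 * π * 1) * y) * Real.exp (-(2 * π * (α - 1)) * y) =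
        Real.exp (-(2 * π * α) * y) := by
      rw [← Real.exp_add]; ring_nf
    have := mul_le_mul_of_nonneg_right hn (Real.exp_pos (-(2 * π * α) * y)).le
    simp only [Complex.ofReal_one, one_mul, Complex.ofReal_zero, add_zero]
    calc _ = _ := by ring
      _ ≤ _ := this
      _ = _ := by rw [← hexp]; ring

lemma scale_eq_one_of_linear_relation {α β : ℝ} (hα : 0 < α) {a b c : ℂ} (ha : a ≠ 0) (hb : b ≠ 0)
    (h : ∀ z : ℂ, 0 < z.im → a * jFun z + b * jFun (α * z + β) + c = 0) : α = 1 := by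
  refine le_antisymm (scale_le_one_of_linear_relation hα hb h) ?_
  have := scale_le_one_of_linear_relation (α := α⁻¹) (β := -(α⁻¹ * β)) (a := b) (c := c)
    (inv_pos.mpr hα) ha fun z hz ↦ ?_
  · exact (inv_le_one₀ hα).mp this
  have hα' : (α : ℂ) ≠ 0 := by exact_mod_cast hα.ne'
  have := h ((α : ℂ)⁻¹ * z - (α : ℂ)⁻¹ * β) (by
    have : 0 < α⁻¹ * z.im := by positivity
    simpa [← Complex.ofReal_inv] using this)
  rw [show (α : ℂ) * ((α : ℂ)⁻¹ * z - (α : ℂ)⁻¹ * β) + β = z by field_simp; ring] at this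
  push_cast
  rw [← sub_eq_add_neg]
  linear_combination this

lemma moebius_denom_ne_zero {γ : Matrix (Fin 2) (Fin 2) ℚ} (hγ : γ.det ≠ 0) {z : ℂ}
    (hz : z.im ≠ 0) : (γ 1 0 : ℂ) * z + (γ 1 1 : ℂ) ≠ 0 := by
  intro h
  have him := congrArg Complex.im h
  have hre := congrArg Complex.re h
  simp only [Complex.add_im, Complex.mul_im, Complex.add_re, Complex.mul_re, Complex.ratCast_im,
    Complex.ratCast_re, Complex.zero_im, Complex.zero_re, zero_mul, add_zero, sub_zero,
    mul_eq_zero, hz, or_false, Rat.cast_eq_zero] at him hre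
  rw [him, Rat.cast_zero, zero_mul, zero_add, Rat.cast_eq_zero] at hre
  exact hγ (by rw [Matrix.det_fin_two, him, hre]; ring)

lemma moebius_moebius (σ : Matrix (Fin 2) (Fin 2) ℚ) {τ : Matrix (Fin 2) (Fin 2) ℚ}
    (hτ : τ.det ≠ 0) {z : ℂ} (hz : z.im ≠ 0) :
    moebius σ (moebius τ z) = moebius (σ * τ) z := by
  have h := moebius_denom_ne_zero hτ hz
  simp only [moebius, Matrix.mul_apply, Fin.sum_univ_two, Rat.cast_add, Rat.cast_mul]
  rw [← mul_div_mul_right _ _ h]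
  congr 1 <;> rw [add_mul, mul_assoc, div_mul_cancel₀ _ h] <;> ring

lemma moebius_im_pos {γ : Matrix (Fin 2) (Fin 2) ℚ} (hγ : 0 < γ.det) {z : ℂ} (hz : 0 < z.im) :
    0 < (moebius γ z).im := by
  have h := moebius_denom_ne_zero hγ.ne' hz.ne'
  have hd : (0 : ℝ) < γ.det := by exact_mod_cast hγ
  have : (moebius γ z).im =
      γ.det * z.im / Complex.normSq ((γ 1 0 : ℂ) * z + (γ 1 1 : ℂ)) := by
    rw [moebius, Complex.div_im, ← sub_div, Matrix.det_fin_two]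
    congr 1
    simp
    ring
  rw [this]
  have := Complex.normSq_pos.mpr h
  positivity

lemma moebius_smul {d : ℚ} (hd : d ≠ 0) (γ : Matrix (Fin 2) (Fin 2) ℚ) (z : ℂ) :
    moebius (d • γ) z = moebius γ z := by
  have hd' : (d : ℂ) ≠ 0 := by exact_mod_cast hd
  simp only [moebius, Matrix.smul_apply, smul_eq_mul, Rat.cast_mul, mul_assoc, ← mul_add]
  exact mul_div_mul_left _ _ hd'

lemma jFun_moebius_intCast (γ : SL(2, ℤ)) {z : ℂ} (hz : 0 < z.im) :
    jFun (moebius (γ.val.map (Int.cast : ℤ → ℚ)) z) = jFun z := by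
  have := jFun_smul γ ⟨z, hz⟩
  rw [coe_specialLinearGroup_apply] at this
  simpa [moebius] using this

lemma jFun_add_intCast (n : ℤ) {z : ℂ} (hz : 0 < z.im) : jFun (z + n) = jFun z := by
  have := jFun_moebius_intCast (ModularGroup.T ^ n) hz
  simpa [moebius, ModularGroup.coe_T_zpow] using this

lemma exists_rat_mul_isCoprime {x y : ℚ} (h : ¬(x = 0 ∧ y = 0)) :
    ∃ (r : ℚ) (p q : ℤ), IsCoprime p q ∧ x = r * p ∧ y = r * q := by
  have hg : 0 < Int.gcd (x.num * y.den) (y.num * x.den) := by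
    rw [Int.gcd_pos_iff]
    by_contra! h'
    simp at h'
    exact h h'
  obtain ⟨p, q, hpq, hp, hq⟩ := Int.exists_gcd_one hg
  refine ⟨Int.gcd (x.num * y.den) (y.num * x.den) / (x.den * y.den), p, q,
    Int.isCoprime_iff_gcd_eq_one.mpr hpq, ?_, ?_⟩
  · have hp' : (x.num * y.den : ℚ) = p * Int.gcd (x.num * y.den) (y.num * x.den) := by
      exact_mod_cast hp
    rw [div_mul_eq_mul_div, mul_comm _ (p : ℚ), ← hp']
    nth_rw 1 [← Rat.num_div_den x]
    field_simp
  · have hq' : (y.num * x.den : ℚ) = q * Int.gcd (x.num * y.den) (y.num * x.den) := by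
      exact_mod_cast hq
    rw [div_mul_eq_mul_div, mul_comm _ (q : ℚ), ← hq']
    nth_rw 1 [← Rat.num_div_den y]
    field_simp

/-- Hermite normal form: modulo `SL(2, ℤ)`, a rational Möbius map acts as a rescaling followed by a
translation, where the scale is determined by the content of the first column. -/
lemma exists_jFun_moebius_eq {σ : Matrix (Fin 2) (Fin 2) ℚ} (hσ : 0 < σ.det) :
    ∃ (r : ℚ) (p q : ℤ) (β : ℚ), r ≠ 0 ∧ σ 0 0 = r * p ∧ σ 1 0 = r * q ∧
      ∀ z : ℂ, 0 < z.im → jFun (moebius σ z) = jFun ((r ^ 2 / σ.det : ℚ) * z + β) := by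
  have hcol : ¬(σ 0 0 = 0 ∧ σ 1 0 = 0) := fun ⟨h0, h1⟩ ↦ hσ.ne' (by
    rw [Matrix.det_fin_two, h0, h1]; ring)
  obtain ⟨r, p, q, hpq, hp, hq⟩ := exists_rat_mul_isCoprime hcol
  have hr : r ≠ 0 := by rintro rfl; simp_all
  obtain ⟨τ, hτp, hτq⟩ := hpq.exists_SL2_col 0
  have hdet := τ.det_coe
  rw [Matrix.det_fin_two, hτp, hτq] at hdet
  have hdet' : (p * τ 1 1 - τ 0 1 * q : ℚ) = 1 := by exact_mod_cast hdet
  set s : ℚ := τ 1 1 * σ 0 1 - τ 0 1 * σ 1 1 with hs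
  set U : Matrix (Fin 2) (Fin 2) ℚ := !![r, s; 0, σ.det / r] with hU
  have hUdet : U.det = σ.det := by rw [hU, Matrix.det_fin_two_of]; field_simp; ring
  have hmul : σ = τ.val.map (Int.cast : ℤ → ℚ) * U := by
    ext i j
    have hd := Matrix.det_fin_two σ
    rw [hp, hq] at hd
    fin_cases i <;> fin_cases j <;>
      simp [Matrix.mul_apply, hU, hp, hq, hτp, hτq, mul_comm r]
    · rw [hd, hs]
      field_simp
      linear_combination (-σ 0 1) * hdet'
    · rw [hd, hs]
      field_simp
      linear_combination (-σ 1 1) * hdet'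
  refine ⟨r, p, q, s * r / σ.det, hr, hp, hq, fun z hz ↦ ?_⟩
  have hUz := moebius_im_pos (hUdet.symm ▸ hσ) hz
  have h1 : moebius σ z = moebius (τ.val.map (Int.cast : ℤ → ℚ)) (moebius U z) := by
    rw [moebius_moebius _ (hUdet.symm ▸ hσ.ne') hz.ne', ← hmul]
  rw [h1, jFun_moebius_intCast τ hUz]
  congr 1
  have hr' : (r : ℂ) ≠ 0 := by exact_mod_cast hr
  have hd' : (σ.det : ℂ) ≠ 0 := by exact_mod_cast hσ.ne'
  simp only [moebius, hU]
  simp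
  field_simp

/-- The content of the first column of a matrix whose `j`-map is linearly related to `j`. -/
lemma exists_first_column_of_linear_relation {σ : Matrix (Fin 2) (Fin 2) ℚ} (hσ : 0 < σ.det)
    {a b c : ℂ} (ha : a ≠ 0) (hb : b ≠ 0)
    (h : ∀ z : ℂ, 0 < z.im → a * jFun z + b * jFun (moebius σ z) + c = 0) :
    ∃ (r : ℚ) (p q : ℤ) (β : ℚ), r ^ 2 = σ.det ∧ σ 0 0 = r * p ∧ σ 1 0 = r * q ∧
      ∀ z : ℂ, 0 < z.im → jFun (moebius σ z) = jFun (z + β) := by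
  obtain ⟨r, p, q, β, hr, hp, hq, hj⟩ := exists_jFun_moebius_eq hσ
  have hα : (0 : ℝ) < (r ^ 2 / σ.det : ℚ) := by
    have : 0 < r ^ 2 / σ.det := by positivity
    exact_mod_cast this
  have h1 := scale_eq_one_of_linear_relation (β := (β : ℝ)) (c := c) hα ha hb fun z hz ↦ by
    have := h z hz
    rw [hj z hz] at this
    exact_mod_cast this
  have h1' : r ^ 2 / σ.det = 1 := by exact_mod_cast h1
  refine ⟨r, p, q, β, by rwa [div_eq_one_iff_eq hσ.ne'] at h1', hp, hq, fun z hz ↦ ?_⟩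
  rw [hj z hz, h1', Rat.cast_one, one_mul]

lemma jFun_moebius_eq_of_linear_relation {σ : Matrix (Fin 2) (Fin 2) ℚ} (hσ : 0 < σ.det)
    {a b c : ℂ} (ha : a ≠ 0) (hb : b ≠ 0)
    (h : ∀ z : ℂ, 0 < z.im → a * jFun z + b * jFun (moebius σ z) + c = 0)
    {z : ℂ} (hz : 0 < z.im) : jFun (moebius σ z) = jFun z := by
  obtain ⟨-, -, -, β, -, -, -, hj⟩ := exists_first_column_of_linear_relation hσ ha hb h
  set ρ : Matrix (Fin 2) (Fin 2) ℚ := !![β, -1; 1, 0] with hρ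
  have hρdet : ρ.det = 1 := by simp [hρ, Matrix.det_fin_two_of]
  obtain ⟨r, p, -, -, hr, hp, -, -⟩ := exists_first_column_of_linear_relation (σ := ρ) (c := c)
    (by simp [hρdet]) ha hb fun w hw ↦ by
      have hw0 : w ≠ 0 := by rintro rfl; simp at hw
      have hSw := jFun_smul ModularGroup.S ⟨w, hw⟩
      have him := (ModularGroup.S • (⟨w, hw⟩ : ℍ)).im_pos
      rw [← coe_im] at him
      rw [modular_S_smul] at hSw him
      have := h _ him
      rw [hj _ him, hSw] at this
      convert this using 4
      simp [hρ, moebius]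
      field_simp
      ring_nf
  have hβ : ∃ n : ℤ, β = n := by
    have hp' : β = r * p := hp
    rcases sq_eq_one_iff.mp (hr.trans hρdet) with rfl | rfl
    · exact ⟨p, by simpa using hp'⟩
    · exact ⟨-p, by simpa using hp'⟩
  obtain ⟨n, rfl⟩ := hβ
  rw [hj z hz, Rat.cast_intCast, jFun_add_intCast n hz]

lemma not_jFun_const (a b : ℂ) (ha : a ≠ 0) : ¬ ∀ z : ℂ, 0 < z.im → a * jFun z + b = 0 := by
  intro h
  have := scale_le_one_of_linear_relation (α := 2) (β := 0) (a := 0) (c := b) two_pos ha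
    fun z hz ↦ by
      simpa using h (2 * z) (by simpa)
  norm_num at this

/-- If two non-constant `j`-maps `f(z) = j(γz)`, `g(z) = j(δz)` (with `γ, δ ∈ GL₂⁺(ℚ)`)
satisfy a non-trivial linear relation `af + bg + c = 0` on the upper half-plane, then
`f = g`, `a + b = 0`, and `c = 0`. -/
theorem j_maps_linear_relation (γ δ : Matrix (Fin 2) (Fin 2) ℚ)
    (hγ : 0 < γ.det) (hδ : 0 < δ.det)
    (f g : ℂ → ℂ)
    (hf : ∀ z : ℂ, 0 < z.im → f z = jFun (moebius γ z))
    (hg : ∀ z : ℂ, 0 < z.im → g z = jFun (moebius δ z))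
    (a b c : ℂ) (habc : ¬(a = 0 ∧ b = 0 ∧ c = 0))
    (hlin : ∀ z : ℂ, 0 < z.im → a * f z + b * g z + c = 0) :
    (∀ z : ℂ, 0 < z.im → f z = g z) ∧ a + b = 0 ∧ c = 0 := by
  have hγa : γ.adjugate.det = γ.det := by simp [Matrix.det_adjugate]
  have hσ : 0 < (δ * γ.adjugate).det := by
    rw [Matrix.det_mul, hγa]
    positivity
  have hrel (w : ℂ) (hw : 0 < w.im) :
      a * jFun w + b * jFun (moebius (δ * γ.adjugate) w) + c = 0 := by
    have hw' := moebius_im_pos (hγa.symm ▸ hγ) hw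
    have := hlin _ hw'
    rwa [hf _ hw', hg _ hw', moebius_moebius _ (hγa.symm ▸ hγ.ne') hw.ne',
      moebius_moebius _ (hγa.symm ▸ hγ.ne') hw.ne', Matrix.mul_adjugate, moebius_smul hγ.ne',
      show moebius 1 w = w by simp [moebius]] at this
  have hσz {z : ℂ} (hz : 0 < z.im) :
      moebius (δ * γ.adjugate) (moebius γ z) = moebius δ z := by
    rw [moebius_moebius _ hγ.ne' hz.ne', Matrix.mul_assoc, Matrix.adjugate_mul,
      Matrix.mul_smul, Matrix.mul_one, moebius_smul hγ.ne']
  have hc_ne : ¬(a = 0 ∧ b = 0) := fun ⟨ha, hb⟩ ↦ habc ⟨ha, hb, by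
    simpa [ha, hb] using hrel Complex.I (by simp)⟩
  have hb : b ≠ 0 := fun hb ↦ not_jFun_const a c (fun ha ↦ hc_ne ⟨ha, hb⟩) fun z hz ↦ by
    simpa [hb] using hrel z hz
  have ha : a ≠ 0 := fun ha ↦ not_jFun_const b c hb fun z hz ↦ by
    have hz' := moebius_im_pos (γ := (δ * γ.adjugate).adjugate) (by
      simpa [Matrix.det_adjugate] using hσ) hz
    have := hrel _ hz'
    rwa [moebius_moebius _ (by simpa [Matrix.det_adjugate] using hσ.ne') hz.ne',
      Matrix.mul_adjugate, moebius_smul hσ.ne', show moebius 1 z = z by simp [moebius], ha,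
      zero_mul, zero_add] at this
  have heq {w : ℂ} (hw : 0 < w.im) := jFun_moebius_eq_of_linear_relation hσ ha hb hrel hw
  have hab : a + b = 0 := by
    by_contra hab
    refine not_jFun_const (a + b) c hab fun z hz ↦ ?_
    have := hrel z hz
    rw [heq hz] at this
    linear_combination this
  refine ⟨fun z hz ↦ ?_, hab, ?_⟩
  · rw [hf z hz, hg z hz, ← hσz hz, heq (moebius_im_pos hγ hz)]
  · have := hrel Complex.I (by simp)
    rw [heq (by simp)] at this
    linear_combination this - jFun Complex.I * hab
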